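/- Let M be a (k+1)×n real matrix with n ≥ k+1 and tropical rank k. Then the Kapranov rank of M equals k. -/

import Mathlib

open scoped Classical

noncomputable section

/-- The field of generalized Puiseux series: Hahn series with real exponents
and complex coefficients. -/
abbrev Ktilde : Type := HahnSeries ℝ ℂ

/-- The order (least exponent) of a generalized Puiseux series. -/
def ord (x : Ktilde) : ℝ := x.order

/-- The leading coefficient of a generalized Puiseux series. -/
def orc (x : Ktilde) : ℂ := x.coeff x.order

/-- The tropical determinant of a square real matrix. -/
def tropDet {r : ℕ} (A : Matrix (Fin r) (Fin r) ℝ) : ℝ :=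
  sInf {v | ∃ σ : Equiv.Perm (Fin r), v = ∑ i, A i (σ i)}

/-- A square real matrix is tropically singular if the minimum in its
tropical determinant is attained by at least two permutations. -/
def TropSingular {r : ℕ} (A : Matrix (Fin r) (Fin r) ℝ) : Prop :=
  ∃ σ τ : Equiv.Perm (Fin r), σ ≠ τ ∧
    (∑ i, A i (σ i)) = tropDet A ∧ (∑ i, A i (τ i)) = tropDet A

/-- The tropical rank: the largest size of a tropically nonsingular square
submatrix. -/
def tropRank {m n : ℕ} (M : Matrix (Fin m) (Fin n) ℝ) : ℕ :=
  sSup {r | ∃ ri : Fin r → Fin m, ∃ ci : Fin r → Fin n,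
    Function.Injective ri ∧ Function.Injective ci ∧
    ¬ TropSingular (M.submatrix ri ci)}

/-- `F` is a lift of the real matrix `M`: all entries of `F` are nonzero
generalized Puiseux series whose orders are the entries of `M`. -/
def IsLift {m n : ℕ} (F : Matrix (Fin m) (Fin n) Ktilde)
    (M : Matrix (Fin m) (Fin n) ℝ) : Prop :=
  ∀ i j, F i j ≠ 0 ∧ ord (F i j) = M i j

/-- The Kapranov rank: the smallest classical rank of a lift of `M` to the
field of generalized Puiseux series. -/
def kapRank {m n : ℕ} (M : Matrix (Fin m) (Fin n) ℝ) : ℕ :=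
  sInf {r | ∃ F : Matrix (Fin m) (Fin n) Ktilde, IsLift F M ∧ F.rank ≤ r}

/-- The Barvinok rank: the smallest `r` such that `M` is the entrywise
(min-plus) sum of `r` tropical products of a column by a row. -/
def barvRank {m n : ℕ} (M : Matrix (Fin m) (Fin n) ℝ) : ℕ :=
  sInf {r | ∃ (A : Fin r → Fin m → ℝ) (B : Fin r → Fin n → ℝ),
    ∀ i j, IsLeast {v | ∃ l : Fin r, v = A l i + B l j} (M i j)}

section Topical

variable {ι : Type*} [Fintype ι] {φ : (ι → ℝ) → ι → ℝ}

/-- A monotone map commuting with addition of constants is nonexpansive for the sup norm. -/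
theorem lipschitzWith_one_of_topical
    (hφ : ∀ (a b : ι → ℝ) (d : ℝ), (∀ i, a i ≤ b i + d) → ∀ i, φ a i ≤ φ b i + d) :
    LipschitzWith 1 φ := by
  refine LipschitzWith.of_dist_le_mul fun a b => ?_
  rw [NNReal.coe_one, one_mul, dist_pi_le_iff dist_nonneg]
  have key : ∀ a b : ι → ℝ, ∀ i, φ a i - φ b i ≤ dist a b := fun a b i => by
    have := hφ a b (dist a b) (fun i => by
      have := (le_abs_self (a i - b i)).trans (dist_le_pi_dist a b i)
      linarith) i
    linarith
  intro i
  rw [Real.dist_eq, abs_sub_le_iff]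
  exact ⟨key a b i, dist_comm a b ▸ key b a i⟩

/-- For every `0 < δ < 1`, the discounted equation `a = φ ((1 - δ) a)` has a solution. -/
theorem exists_discounted_fixedPoint
    (hφ : ∀ (a b : ι → ℝ) (d : ℝ), (∀ i, a i ≤ b i + d) → ∀ i, φ a i ≤ φ b i + d)
    {δ : ℝ} (hδ : 0 < δ) (hδ' : δ < 1) : ∃ a, φ ((1 - δ) • a) = a := by
  have hc : ContractingWith (1 - δ).toNNReal (fun a => φ ((1 - δ) • a)) := by
    refine ⟨?_, LipschitzWith.of_dist_le_mul fun a b => ?_⟩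
    · rwa [Real.toNNReal_lt_one, sub_lt_self_iff]
    have h1 := (lipschitzWith_one_of_topical hφ).dist_le_mul ((1 - δ) • a) ((1 - δ) • b)
    rw [dist_smul₀, Real.norm_of_nonneg (by linarith)] at h1
    rwa [Real.coe_toNNReal _ (by linarith), ← one_mul ((1 - δ) * _)]
  exact ⟨_, hc.fixedPoint_isFixedPt⟩

/-- A map that is monotone, commutes with addition of constants and has all values close to
coordinates of other indices has either a strict subsolution or a supersolution. -/
theorem exists_lt_or_exists_ge_of_topical [Nonempty ι]
    (hφ : ∀ (a b : ι → ℝ) (d : ℝ), (∀ i, a i ≤ b i + d) → ∀ i, φ a i ≤ φ b i + d)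
    {C : ℝ} (hC : 0 ≤ C) (hle : ∀ a i k, k ≠ i → φ a i ≤ a k + C)
    (hge : ∀ a i, ∃ k, a k ≤ φ a i + C) :
    (∃ a, ∀ i, a i < φ a i) ∨ ∃ a, ∀ i, φ a i ≤ a i := by
  by_contra! hcon
  obtain ⟨hneg, hpos⟩ := hcon
  have hcont : Continuous φ := (lipschitzWith_one_of_topical hφ).continuous
  let g : (ι → ℝ) → ℝ := fun b => ∑ i, max (φ b i - b i) 0
  have hg : Continuous g := by fun_prop
  obtain ⟨b, -, hb⟩ := (isCompact_Icc (a := (0 : ι → ℝ)) (b := fun _ => 2 * C)).exists_isMinOn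
    ⟨0, le_refl _, fun _ => by simpa using hC⟩ hg.continuousOn
  have hsmall : ∀ δ : ℝ, 0 < δ → δ < 1 → g b ≤ Fintype.card ι * (2 * C) * δ := by
    intro δ hδ hδ'
    obtain ⟨a, ha⟩ := exists_discounted_fixedPoint hφ hδ hδ'
    obtain ⟨p, hp⟩ := Finite.exists_min a
    obtain ⟨i₀, hi₀⟩ := hneg ((1 - δ) • a)
    have hap : a p ≤ 0 := by
      rw [ha, Pi.smul_apply, smul_eq_mul] at hi₀
      have := hp i₀
      nlinarith
    have hlow : (1 - δ) * a p - C ≤ a p := by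
      obtain ⟨k, hk⟩ := hge ((1 - δ) • a) p
      rw [ha, Pi.smul_apply, smul_eq_mul] at hk
      have := mul_le_mul_of_nonneg_left (hp k) (by linarith : 0 ≤ 1 - δ)
      linarith
    have hspread : ∀ i, a i ≤ a p + 2 * C := by
      intro i
      rcases eq_or_ne p i with rfl | hpi
      · linarith
      · have := hle ((1 - δ) • a) i p hpi
        rw [ha, Pi.smul_apply, smul_eq_mul] at this
        linarith
    let c : ι → ℝ := fun i => (1 - δ) * a i - (1 - δ) * a p
    have hc : c ∈ Set.Icc (0 : ι → ℝ) (fun _ => 2 * C) := by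
      refine ⟨fun i => ?_, fun i => ?_⟩
      · have := hp i
        simp only [c, Pi.zero_apply]
        nlinarith
      · have := hspread i
        simp only [c]
        nlinarith [hp i]
    have hterm : ∀ i, max (φ c i - c i) 0 ≤ 2 * C * δ := by
      intro i
      refine max_le ?_ (by positivity)
      have := hφ c ((1 - δ) • a) (-((1 - δ) * a p)) (fun i => by simp [c]) i
      rw [ha] at this
      simp only [c] at this ⊢
      nlinarith [hspread i]
    calc g b ≤ g c := hb hc
      _ ≤ ∑ _i : ι, 2 * C * δ := Finset.sum_le_sum fun i _ => hterm i
      _ = Fintype.card ι * (2 * C) * δ := by simp; ring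
  obtain ⟨i, hi⟩ := hpos b
  have hgb : 0 < g b := (sub_pos.2 hi).trans_le ((le_max_left _ _).trans
    (Finset.single_le_sum (f := fun i => max (φ b i - b i) 0)
      (fun i _ => le_max_right _ _) (Finset.mem_univ i)))
  have hlim : Filter.Tendsto (fun δ : ℝ => Fintype.card ι * (2 * C) * δ)
      (nhdsWithin 0 (Set.Ioi 0)) (nhds 0) := by
    have : Continuous fun δ : ℝ => Fintype.card ι * (2 * C) * δ := by fun_prop
    simpa using (this.tendsto 0).mono_left nhdsWithin_le_nhds
  refine hgb.not_ge (ge_of_tendsto hlim ?_)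
  filter_upwards [Ioo_mem_nhdsGT (zero_lt_one' ℝ)] with δ hδ using hsmall δ hδ.1 hδ.2

end Topical

/-- Either the columns of `M` all lie on a common tropical hyperplane, or some row scaling makes
every row the unique minimizer of some column. -/
theorem exists_tropical_hyperplane_or_dominant {k n : ℕ} (hk : 0 < k) (hn : 0 < n)
    (M : Matrix (Fin (k + 1)) (Fin n) ℝ) :
    (∃ a : Fin (k + 1) → ℝ, ∃ c : Fin (k + 1) → Fin n,
      ∀ i l, l ≠ i → a i + M i (c i) < a l + M l (c i)) ∨
    ∃ a : Fin (k + 1) → ℝ, ∀ i j, ∃ l, l ≠ i ∧ a l + M l j ≤ a i + M i j := by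
  have : Nonempty (Fin n) := ⟨⟨0, hn⟩⟩
  have : Nontrivial (Fin (k + 1)) := Fin.nontrivial_iff_two_le.2 (by omega)
  have hne : ∀ i : Fin (k + 1), (Finset.univ.erase i).Nonempty := fun i => by
    obtain ⟨l, hl⟩ := exists_ne i
    exact ⟨l, by simpa using hl⟩
  obtain ⟨φ, hφ⟩ : ∃ φ : (Fin (k + 1) → ℝ) → Fin (k + 1) → ℝ, ∀ a i t,
      φ a i ≤ t ↔ ∀ j, ∃ l, l ≠ i ∧ a l + M l j ≤ t + M i j :=
    ⟨fun a i => Finset.univ.sup' Finset.univ_nonempty fun j =>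
      (Finset.univ.erase i).inf' (hne i) fun l => a l + M l j - M i j, fun a i t => by
        simp [Finset.sup'_le_iff, Finset.inf'_le_iff]⟩
  obtain ⟨B, hB⟩ := Finite.exists_max fun x : Fin (k + 1) × Fin n => |M x.1 x.2|
  have hM : ∀ i j, |M i j| ≤ |M B.1 B.2| := fun i j => hB (i, j)
  rcases exists_lt_or_exists_ge_of_topical (φ := φ) (C := 2 * |M B.1 B.2|)
    (fun a b d hab i => (hφ a i _).2 fun j => by
      obtain ⟨l, hl, h⟩ := (hφ b i _).1 le_rfl j
      exact ⟨l, hl, by linarith [hab l]⟩)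
    (by positivity)
    (fun a i l hl => (hφ a i _).2 fun j =>
      ⟨l, hl, by linarith [(abs_le.1 (hM l j)).2, (abs_le.1 (hM i j)).1]⟩)
    (fun a i => by
      obtain ⟨l, -, h⟩ := (hφ a i _).1 le_rfl ⟨0, hn⟩
      exact ⟨l, by linarith [(abs_le.1 (hM l ⟨0, hn⟩)).1, (abs_le.1 (hM i ⟨0, hn⟩)).2]⟩)
    with ⟨a, ha⟩ | ⟨a, ha⟩
  · left
    have h : ∀ i, ∃ j, ∀ l, l ≠ i → a i + M i j < a l + M l j := fun i => by
      have := ha i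
      rw [← not_le, hφ] at this
      push Not at this
      exact this
    choose c hc using h
    exact ⟨a, c, hc⟩
  · exact Or.inr ⟨a, fun i => (hφ a i _).1 (ha i)⟩

theorem tropDet_le {r : ℕ} (A : Matrix (Fin r) (Fin r) ℝ) (σ : Equiv.Perm (Fin r)) :
    tropDet A ≤ ∑ i, A i (σ i) :=
  csInf_le ((Set.finite_range fun σ : Equiv.Perm (Fin r) => ∑ i, A i (σ i)).subset
    (by rintro _ ⟨σ, rfl⟩; exact ⟨σ, rfl⟩)).bddBelow ⟨σ, rfl⟩

/-- A square matrix is tropically nonsingular iff one permutation is strictly optimal. -/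
theorem not_tropSingular_iff {r : ℕ} (A : Matrix (Fin r) (Fin r) ℝ) :
    ¬ TropSingular A ↔
      ∃ σ : Equiv.Perm (Fin r), ∀ τ, τ ≠ σ → ∑ i, A i (σ i) < ∑ i, A i (τ i) := by
  obtain ⟨σ, hσ⟩ := Finite.exists_min fun σ : Equiv.Perm (Fin r) => ∑ i, A i (σ i)
  have hdet : tropDet A = ∑ i, A i (σ i) :=
    le_antisymm (tropDet_le A σ) (le_csInf ⟨_, σ, rfl⟩ (by rintro _ ⟨τ, rfl⟩; exact hσ τ))
  constructor
  · intro h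
    refine ⟨σ, fun τ hτ => (hσ τ).lt_of_ne fun heq => h ⟨τ, σ, hτ, ?_, hdet.symm⟩⟩
    rw [hdet, heq]
  · rintro ⟨ρ, hρ⟩ ⟨τ₁, τ₂, hne, h₁, h₂⟩
    have key : ∀ τ : Equiv.Perm (Fin r), ∑ i, A i (τ i) = tropDet A → τ = ρ := fun τ hτ => by
      by_contra hcon
      exact (hρ τ hcon).not_ge (hτ.trans_le (tropDet_le A ρ))
    exact hne ((key τ₁ h₁).trans (key τ₂ h₂).symm)

theorem bddAbove_nonsingular_sizes {m n : ℕ} (M : Matrix (Fin m) (Fin n) ℝ) :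
    BddAbove {r | ∃ ri : Fin r → Fin m, ∃ ci : Fin r → Fin n,
      Function.Injective ri ∧ Function.Injective ci ∧ ¬ TropSingular (M.submatrix ri ci)} := by
  refine ⟨m, ?_⟩
  rintro r ⟨ri, -, hri, -⟩
  simpa using Fintype.card_le_of_injective ri hri

/-- The tropical rank is attained by a tropically nonsingular submatrix. -/
theorem exists_nonsingular_of_tropRank {m n : ℕ} (M : Matrix (Fin m) (Fin n) ℝ) :
    ∃ ri : Fin (tropRank M) → Fin m, ∃ ci : Fin (tropRank M) → Fin n,
      Function.Injective ri ∧ Function.Injective ci ∧ ¬ TropSingular (M.submatrix ri ci) :=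
  Nat.sSup_mem (s := {r | ∃ ri : Fin r → Fin m, ∃ ci : Fin r → Fin n,
      Function.Injective ri ∧ Function.Injective ci ∧ ¬ TropSingular (M.submatrix ri ci)})
    ⟨0, Fin.elim0, Fin.elim0, Function.injective_of_subsingleton _,
      Function.injective_of_subsingleton _, fun ⟨σ, τ, h, _⟩ => h (Subsingleton.elim σ τ)⟩
    (bddAbove_nonsingular_sizes M)

/-- If every row is the strict minimizer of some column, after rescaling the rows, then the
matrix has full tropical rank. -/
theorem le_tropRank_of_dominant {m n : ℕ} (M : Matrix (Fin m) (Fin n) ℝ) (a : Fin m → ℝ)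
    (c : Fin m → Fin n) (hc : ∀ i l, l ≠ i → a i + M i (c i) < a l + M l (c i)) :
    m ≤ tropRank M := by
  refine le_csSup (bddAbove_nonsingular_sizes M) ⟨id, c, Function.injective_id, ?_, ?_⟩
  · intro i l hil
    by_contra hne
    have h₁ := hc i l (Ne.symm hne)
    have h₂ := hc l i hne
    rw [hil] at h₁
    exact lt_asymm h₁ h₂
  · refine (not_tropSingular_iff _).2 ⟨1, fun τ hτ => ?_⟩
    have hlt : ∑ i, (a (τ i) + M (τ i) (c (τ i))) < ∑ i, (a i + M i (c (τ i))) := by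
      obtain ⟨i, hi⟩ : ∃ i, τ i ≠ i := by
        by_contra! h
        exact hτ (Equiv.ext h)
      refine Finset.sum_lt_sum (fun i _ => ?_) ⟨i, Finset.mem_univ i, hc _ _ hi.symm⟩
      rcases eq_or_ne i (τ i) with h | h
      · rw [← h]
      · exact (hc _ _ h).le
    rw [Equiv.sum_comp τ fun i => a i + M i (c i), Finset.sum_add_distrib,
      Finset.sum_add_distrib] at hlt
    simpa using hlt

theorem order_prod_of_ne_zero {ι : Type*} (s : Finset ι) (f : ι → Ktilde)
    (hf : ∀ i ∈ s, f i ≠ 0) : (∏ i ∈ s, f i).order = ∑ i ∈ s, (f i).order := by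
  induction s using Finset.cons_induction with
  | empty => simp
  | cons i s his ih =>
    rw [Finset.prod_cons, Finset.sum_cons, HahnSeries.order_mul (hf i (Finset.mem_cons_self i s))
      (Finset.prod_ne_zero_iff.2 fun l hl => hf l (Finset.mem_cons_of_mem hl)),
      ih fun l hl => hf l (Finset.mem_cons_of_mem hl)]

/-- A lift of a tropically nonsingular matrix is nonsingular. -/
theorem IsLift.det_ne_zero {r : ℕ} {F : Matrix (Fin r) (Fin r) Ktilde}
    {A : Matrix (Fin r) (Fin r) ℝ} (hF : IsLift F A) (hA : ¬ TropSingular A) : F.det ≠ 0 := by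
  obtain ⟨σ, hσ⟩ := (not_tropSingular_iff A).1 hA
  have hord : ∀ τ : Equiv.Perm (Fin r), (∏ i, F i (τ i)).order = ∑ i, A i (τ i) := fun τ => by
    rw [order_prod_of_ne_zero _ _ fun i _ => (hF i _).1]
    exact Finset.sum_congr rfl fun i _ => (hF i _).2
  have hcoeff : F.det.coeff (∑ i, A i (σ i)) ≠ 0 := by
    rw [← Matrix.det_transpose, Matrix.det_apply, HahnSeries.coeff_sum, Finset.sum_eq_single σ]
    · rw [← hord σ]
      have : (∏ i, F i (σ i)).coeff (∏ i, F i (σ i)).order ≠ 0 :=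
        HahnSeries.coeff_order_eq_zero.not.2 (Finset.prod_ne_zero_iff.2 fun i _ => (hF i _).1)
      rcases Int.units_eq_one_or (Equiv.Perm.sign σ) with h | h <;> simpa [h] using this
    · intro τ _ hτ
      have : (∏ i, F i (τ i)).coeff (∑ i, A i (σ i)) = 0 :=
        HahnSeries.coeff_eq_zero_of_lt_order ((hσ τ hτ).trans_eq (hord τ).symm)
      rcases Int.units_eq_one_or (Equiv.Perm.sign τ) with h | h <;> simpa [h] using this
    · simp
  exact fun h => hcoeff (by rw [h]; rfl)

/-- Every lift of `M` has classical rank at least the tropical rank of `M`. -/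
theorem IsLift.tropRank_le_rank {m n : ℕ} {F : Matrix (Fin m) (Fin n) Ktilde}
    {M : Matrix (Fin m) (Fin n) ℝ} (hF : IsLift F M) : tropRank M ≤ F.rank := by
  obtain ⟨ri, ci, -, -, hns⟩ := exists_nonsingular_of_tropRank M
  have hsub : IsLift (F.submatrix ri ci) (M.submatrix ri ci) := fun i j => hF _ _
  calc tropRank M = (F.submatrix ri ci).rank := by
        rw [Matrix.rank_of_isUnit _ ((Matrix.isUnit_iff_isUnit_det _).2
          (isUnit_iff_ne_zero.2 (hsub.det_ne_zero hns))), Fintype.card_fin]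
    _ ≤ F.rank := Matrix.rank_submatrix_le _ _ _

/-- If the minimum of the exponents `e` over `s` is `μ`, then a sum of monic monomials with these
exponents is nonzero of order `μ`. -/
theorem sum_single_ne_zero_and_order {ι : Type*} (s : Finset ι) (e : ι → ℝ) {μ : ℝ}
    (hle : ∀ i ∈ s, μ ≤ e i) (hex : ∃ i ∈ s, e i = μ) :
    (∑ i ∈ s, HahnSeries.single (e i) (1 : ℂ)) ≠ 0 ∧
      (∑ i ∈ s, HahnSeries.single (e i) (1 : ℂ)).order = μ := by
  have hc : ∀ x, (∑ i ∈ s, HahnSeries.single (e i) (1 : ℂ)).coeff x =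
      (s.filter fun i => x = e i).card := fun x => by
    simp [HahnSeries.coeff_sum, HahnSeries.coeff_single]
  have hμ : (∑ i ∈ s, HahnSeries.single (e i) (1 : ℂ)).coeff μ ≠ 0 := by
    obtain ⟨i, hi, rfl⟩ := hex
    rw [hc, Nat.cast_ne_zero, Finset.card_ne_zero]
    exact ⟨i, by simp [hi]⟩
  have hne := HahnSeries.ne_zero_of_coeff_ne_zero hμ
  refine ⟨hne, le_antisymm (HahnSeries.order_le_of_coeff_ne_zero hμ) (not_lt.1 fun hlt => ?_)⟩
  refine hne (HahnSeries.coeff_order_eq_zero.1 ?_)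
  rw [hc, Nat.cast_eq_zero, Finset.card_eq_zero, Finset.filter_eq_empty_iff]
  exact fun i hi h => (hle i hi).not_gt (h ▸ hlt)

/-- A matrix over a field with a nonzero left null vector does not have full row rank. -/
theorem rank_lt_of_vecMul_eq_zero {K : Type*} [Field K] {m n : ℕ} {F : Matrix (Fin m) (Fin n) K}
    {w : Fin m → K} (hw : w ≠ 0) (h : Matrix.vecMul w F = 0) : F.rank < m := by
  refine F.rank_le_height.lt_of_ne fun hr => hw ?_
  have hli : LinearIndependent K F.row := by
    rw [linearIndependent_iff_card_eq_finrank_span, Fintype.card_fin]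
    exact hr.symm.trans F.rank_eq_finrank_span_row
  exact Matrix.vecMul_injective_iff.2 hli (by simpa using h)

/-- Columns on a common tropical hyperplane lift to columns on a common hyperplane. -/
theorem exists_isLift_of_tropical_hyperplane {m n : ℕ} (M : Matrix (Fin m) (Fin n) ℝ)
    (hm : 0 < m) (a : Fin m → ℝ)
    (ha : ∀ i j, ∃ l, l ≠ i ∧ a l + M l j ≤ a i + M i j) :
    ∃ F, IsLift F M ∧ F.rank < m := by
  have : Nonempty (Fin m) := ⟨⟨0, hm⟩⟩
  choose p hp using fun j => Finite.exists_min fun i => a i + M i j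
  let e : Fin m → Fin n → ℝ := fun l j => a l + M l j - a (p j)
  let F : Matrix (Fin m) (Fin n) Ktilde := Matrix.of fun i j =>
    if i = p j then -∑ l ∈ Finset.univ.erase (p j), HahnSeries.single (e l j) (1 : ℂ)
    else HahnSeries.single (M i j) 1
  have hFp : ∀ j, F (p j) j =
      -∑ l ∈ Finset.univ.erase (p j), HahnSeries.single (e l j) (1 : ℂ) := fun j => by simp [F]
  have hFne : ∀ i j, i ≠ p j → F i j = HahnSeries.single (M i j) 1 := fun i j hi => by
    simp [F, hi]
  refine ⟨F, fun i j => ?_, rank_lt_of_vecMul_eq_zero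
    (w := fun i => HahnSeries.single (a i) (1 : ℂ)) (fun h => ?_) ?_⟩
  · by_cases hi : i = p j
    · have h := sum_single_ne_zero_and_order (Finset.univ.erase (p j)) (fun l => e l j)
        (μ := M (p j) j) (fun l _ => by simp only [e]; linarith [hp j l]) (by
          obtain ⟨l, hl, hlj⟩ := ha (p j) j
          exact ⟨l, by simpa using hl, by simp only [e]; linarith [hp j l]⟩)
      rw [hi, hFp, ord, HahnSeries.order_neg, neg_ne_zero]
      exact h
    · rw [hFne i j hi]
      exact ⟨HahnSeries.single_ne_zero one_ne_zero, HahnSeries.order_single one_ne_zero⟩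
  · exact HahnSeries.single_ne_zero (one_ne_zero (α := ℂ)) (congrFun h ⟨0, hm⟩)
  · ext1 j
    change ∑ i, HahnSeries.single (a i) (1 : ℂ) * F i j = 0
    have hS : ∑ l ∈ Finset.univ.erase (p j), HahnSeries.single (a l) (1 : ℂ) * F l j =
        HahnSeries.single (a (p j)) (1 : ℂ) *
          ∑ l ∈ Finset.univ.erase (p j), HahnSeries.single (e l j) (1 : ℂ) := by
      rw [Finset.mul_sum]
      refine Finset.sum_congr rfl fun l hl => ?_
      rw [hFne l j (Finset.ne_of_mem_erase hl), HahnSeries.single_mul_single,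
        HahnSeries.single_mul_single]
      congr 2
      simp only [e]
      ring
    rw [← Finset.add_sum_erase _ _ (Finset.mem_univ (p j)), hFp, hS]
    ring

theorem kapRank_of_tropRank_succ {k n : ℕ} (hn : n ≥ k + 1)
    (M : Matrix (Fin (k + 1)) (Fin n) ℝ) (h : tropRank M = k) :
    kapRank M = k := by
  have hk : 0 < k := by
    rw [Nat.pos_iff_ne_zero]
    rintro rfl
    have := le_tropRank_of_dominant M 0 (fun _ => ⟨0, by omega⟩)
      fun i l hl => absurd (Fin.ext (by omega)) hl
    omega
  obtain ⟨F, hF, hrank⟩ : ∃ F, IsLift F M ∧ F.rank < k + 1 := by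
    rcases exists_tropical_hyperplane_or_dominant hk (by omega) M with ⟨a, c, hc⟩ | ⟨a, ha⟩
    · have := le_tropRank_of_dominant M a c hc
      omega
    · exact exists_isLift_of_tropical_hyperplane M k.succ_pos a ha
  have hmem : k ∈ {r | ∃ F : Matrix (Fin (k + 1)) (Fin n) Ktilde, IsLift F M ∧ F.rank ≤ r} :=
    ⟨F, hF, Nat.lt_succ_iff.1 hrank⟩
  refine le_antisymm (Nat.sInf_le hmem) (le_csInf ⟨k, hmem⟩ ?_)
  rintro r ⟨G, hG, hr⟩
  exact h ▸ hG.tropRank_le_rank.trans hr
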